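/- Let τ ∈ ℂ with Im τ > 0, q := e^{2πiτ}. Let u, v ∈ ℂ∖(ℤ+ℤτ), α ∈ ℂ, and set x := e^{2πiu}, y := e^{2πiv}, a := q^α. Assume none of y, x/a, a/q², x/y lies in q^ℤ := {q^m : m ∈ ℤ} and qx/y, qy/x ∉ {q^{−m} : m ≥ 0}. Then μ(x,y;a) = −i q^{−1/8} (x/y)^{α/2} (a/x) · [θ(x/q²) θ(qy/a) (a;q)_∞ (qx/y;q)_∞] / [θ(a/q²) θ(y) θ(x/a) θ(x/y)] · ₀φ₁(— ; qx/y ; q, q²x/(ay)) − i q^{−1/8} (x/y)^{α/2} (a/y) · [θ(y/q²) θ(qx/a) (a;q)_∞ (qy/x;q)_∞] / [θ(a/q²) θ(y) θ(x/a) θ(y/x)] · ₀φ₁(— ; qy/x ; q, q²y/(ax)). -/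

import Mathlib

noncomputable section

/-- `e z = exp(2πiz)`. -/
def e (z : ℂ) : ℂ := Complex.exp (2 * (Real.pi : ℂ) * Complex.I * z)

/-- Infinite q-Pochhammer symbol `(a;q)_∞`. -/
def qpinf (a q : ℂ) : ℂ := ∏' j : ℕ, (1 - a * q ^ j)

/-- `(a;q)_n` for `n : ℤ`, defined as `(a;q)_∞ / (a q^n;q)_∞`. -/
def qpint (a q : ℂ) (n : ℤ) : ℂ := qpinf a q / qpinf (a * q ^ n) q

/-- `θ(x) = (x;q)_∞ (q/x;q)_∞`. -/
def qtheta (q x : ℂ) : ℂ := qpinf x q * qpinf (q / x) q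

/-- Jacobi theta `ϑ₁₁(v) = -i q^{1/8} e^{-πiv} (q;q)_∞ θ(e^{2πiv})`. -/
def theta11 (τ v : ℂ) : ℂ :=
  -Complex.I * e (τ / 8) * e (-v / 2) * qpinf (e τ) (e τ) * qtheta (e τ) (e v)

/-- Generalized Zwegers μ-function `μ(u,v;α)`. -/
def genMu (τ u v α : ℂ) : ℂ :=
  e (α * (u - v) / 2) / theta11 τ v *
    ∑' n : ℤ, (-1 : ℂ) ^ n * e (((n : ℂ) + 1 / 2) * v) * (e τ) ^ ((n * (n + 1)) / 2) *
      (qpinf (e u * (e τ) ^ (n + 1)) (e τ) /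
       qpinf (e u * e (τ * ((n : ℂ) - α + 1))) (e τ))

/-- finite q-Pochhammer `(a;q)_n`, `n : ℕ`. -/
def qpn (a q : ℂ) (n : ℕ) : ℂ := ∏ j ∈ Finset.range n, (1 - a * q ^ j)

/-- `₀φ₁(—; c; q, t) = Σ_{n≥0} q^{n(n−1)} t^n / ((c;q)_n (q;q)_n)`. -/
def phi01 (c q t : ℂ) : ℂ := ∑' n : ℕ, q ^ (n * (n - 1)) * t ^ n / (qpn c q n * qpn q q n)

section QSeries

open Filter Topology

/-! ### Infinite products -/

lemma summable_mul_pow {q : ℂ} (hq : ‖q‖ < 1) (a : ℂ) : Summable fun j : ℕ => ‖-(a * q ^ j)‖ := by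
  simp only [norm_neg, norm_mul, norm_pow]
  exact (summable_geometric_of_lt_one (norm_nonneg q) hq).mul_left _

lemma multipliable_qpinf {q : ℂ} (hq : ‖q‖ < 1) (a : ℂ) :
    Multipliable fun j : ℕ => (1 - a * q ^ j) := by
  simpa [sub_eq_add_neg] using multipliable_one_add_of_summable (summable_mul_pow hq a)

lemma qpinf_ne_zero {q : ℂ} (hq : ‖q‖ < 1) {a : ℂ} (h : ∀ j : ℕ, a * q ^ j ≠ 1) :
    qpinf a q ≠ 0 := by
  have := tprod_one_add_ne_zero_of_summable (f := fun j : ℕ => -(a * q ^ j))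
    (fun j => by rw [← sub_eq_add_neg, sub_ne_zero]; exact (h j).symm) (summable_mul_pow hq a)
  simpa [qpinf, sub_eq_add_neg] using this

lemma qpn_succ (a q : ℂ) (n : ℕ) : qpn a q (n + 1) = qpn a q n * (1 - a * q ^ n) :=
  Finset.prod_range_succ _ _

lemma tendsto_qpn {q : ℂ} (hq : ‖q‖ < 1) (a : ℂ) :
    Tendsto (qpn a q) atTop (𝓝 (qpinf a q)) :=
  (multipliable_qpinf hq a).tendsto_prod_tprod_nat

lemma qpn_ne_zero {q a : ℂ} (h : ∀ j : ℕ, a * q ^ j ≠ 1) (n : ℕ) : qpn a q n ≠ 0 :=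
  Finset.prod_ne_zero_iff.2 fun j _ => sub_ne_zero.2 (h j).symm

lemma qpinf_eq_one_sub_mul {q : ℂ} (hq : ‖q‖ < 1) (a : ℂ) :
    qpinf a q = (1 - a) * qpinf (a * q) q := by
  have h1 := (tendsto_add_atTop_iff_nat 1).2 (tendsto_qpn hq a)
  have h2 := (tendsto_qpn hq (a * q)).const_mul (1 - a)
  refine tendsto_nhds_unique h1 (h2.congr fun n => ?_)
  simp only [qpn, Finset.prod_range_succ', pow_zero, mul_one]
  rw [mul_comm]
  congr 1
  exact Finset.prod_congr rfl fun j _ => by ring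

lemma qpinf_eq_qpn_mul {q : ℂ} (hq : ‖q‖ < 1) (a : ℂ) (n : ℕ) :
    qpinf a q = qpn a q n * qpinf (a * q ^ n) q := by
  induction n with
  | zero => simp [qpn]
  | succ n ih =>
    rw [ih, qpinf_eq_one_sub_mul hq (a * q ^ n), qpn_succ, pow_succ]
    ring_nf

lemma tendsto_qpinf_mul_pow {q : ℂ} (hq : ‖q‖ < 1) (a : ℂ) :
    Tendsto (fun n : ℕ => qpinf (a * q ^ n) q) atTop (𝓝 1) := by
  have := tendsto_tprod_one_add_of_dominated_convergence (𝓕 := atTop)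
    (f := fun (n : ℕ) (j : ℕ) => -(a * q ^ n * q ^ j)) (g := fun _ => 0)
    (bound := fun j => ‖-(a * q ^ j)‖) (summable_mul_pow hq a) (fun j => by
      have := ((tendsto_pow_atTop_nhds_zero_of_norm_lt_one hq).const_mul a).mul_const (q ^ j)
      simpa using this.neg)
    (Eventually.of_forall fun n j => by
      simp only [norm_neg, norm_mul, norm_pow]
      have : ‖q‖ ^ n ≤ 1 := pow_le_one₀ (norm_nonneg _) hq.le
      gcongr
      exact mul_le_of_le_one_right (norm_nonneg _) this)
  simpa [qpinf, sub_eq_add_neg] using this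

/-! ### The theta function -/

lemma qtheta_q_mul {q : ℂ} (hq : ‖q‖ < 1) (hq0 : q ≠ 0) {z : ℂ} (hz : z ≠ 0) :
    qtheta q (q * z) = -qtheta q z / z := by
  have h1 := qpinf_eq_one_sub_mul hq z
  have h2 := qpinf_eq_one_sub_mul hq (1 / z)
  have e1 : q / (q * z) = 1 / z := by field_simp
  have e2 : 1 / z * q = q / z := by ring
  rw [e2] at h2
  rw [qtheta, qtheta, e1, h1, h2, mul_comm q z]
  field_simp
  ring

lemma qtheta_q_div {q : ℂ} (hq0 : q ≠ 0) {z : ℂ} (hz : z ≠ 0) :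
    qtheta q (q / z) = qtheta q z := by
  have : q / (q / z) = z := by field_simp
  rw [qtheta, qtheta, this, mul_comm]

lemma qtheta_ne_zero {q : ℂ} (hq : ‖q‖ < 1) (hq0 : q ≠ 0) {z : ℂ} (hz : z ≠ 0)
    (h : ∀ m : ℤ, z ≠ q ^ m) : qtheta q z ≠ 0 := by
  refine mul_ne_zero (qpinf_ne_zero hq fun j hj => h (-j) ?_)
    (qpinf_ne_zero hq fun j hj => h (j + 1) ?_)
  · rw [zpow_neg, zpow_natCast]
    exact eq_inv_of_mul_eq_one_left hj
  · rw [zpow_add_one₀ hq0, zpow_natCast]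
    field_simp at hj
    rw [← hj, mul_comm]

/-! ### Bilateral series with quadratic exponents -/

/-- The coefficient `(-1)^n q^{n(n+1)/2}`. -/
def thetaCoeff (q : ℂ) (n : ℤ) : ℂ := (-1) ^ n * q ^ (n * (n + 1) / 2)

lemma thetaCoeff_zero (q : ℂ) : thetaCoeff q 0 = 1 := by simp [thetaCoeff]

lemma thetaCoeff_ne_zero {q : ℂ} (hq0 : q ≠ 0) (n : ℤ) : thetaCoeff q n ≠ 0 :=
  mul_ne_zero (zpow_ne_zero _ (by norm_num)) (zpow_ne_zero _ hq0)

lemma thetaCoeff_add {q : ℂ} (hq0 : q ≠ 0) (m n : ℤ) :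
    thetaCoeff q (m + n) = thetaCoeff q m * thetaCoeff q n * q ^ (m * n) := by
  have h : (m + n) * (m + n + 1) / 2 = m * (m + 1) / 2 + n * (n + 1) / 2 + m * n := by
    have h1 := Int.ediv_mul_cancel (Int.even_mul_succ_self m).two_dvd
    have h2 := Int.ediv_mul_cancel (Int.even_mul_succ_self n).two_dvd
    have h3 := Int.ediv_mul_cancel (Int.even_mul_succ_self (m + n)).two_dvd
    linarith
  rw [thetaCoeff, h, zpow_add₀ (by norm_num), zpow_add₀ hq0, zpow_add₀ hq0, thetaCoeff, thetaCoeff]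
  ring

lemma thetaCoeff_succ {q : ℂ} (hq0 : q ≠ 0) (n : ℤ) :
    thetaCoeff q (n + 1) = -q ^ (n + 1) * thetaCoeff q n := by
  rw [thetaCoeff_add hq0, zpow_add_one₀ hq0]
  simp [thetaCoeff]
  ring

lemma thetaCoeff_neg_succ {q : ℂ} (hq0 : q ≠ 0) (n : ℕ) :
    thetaCoeff q (-((n + 1 : ℕ) : ℤ)) = -q ^ n * thetaCoeff q (-n) := by
  have h := thetaCoeff_succ hq0 (-((n + 1 : ℕ) : ℤ))
  have e1 : -((n + 1 : ℕ) : ℤ) + 1 = -n := by push_cast; ring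
  rw [e1, zpow_neg, zpow_natCast] at h
  rw [h]
  field_simp

lemma thetaCoeff_neg_mul_self {q : ℂ} (hq0 : q ≠ 0) (n : ℤ) :
    thetaCoeff q (-n) * thetaCoeff q n = q ^ (n * n) := by
  have h := thetaCoeff_add hq0 (-n) n
  rw [neg_add_cancel, thetaCoeff_zero, neg_mul, zpow_neg] at h
  field_simp at h
  exact h.symm

/-- The bilateral series `∑ c_n (-1)^n q^{n(n+1)/2} z^n`. -/
def bilat (c : ℤ → ℂ) (q z : ℂ) : ℂ := ∑' n : ℤ, c n * thetaCoeff q n * z ^ n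

/-- The coefficients are bounded as `n → ∞` and grow at most geometrically as `n → -∞`. -/
def TailBounded (c : ℤ → ℂ) : Prop := ∃ C r : ℝ, 1 ≤ r ∧ ∀ n, ‖c n‖ ≤ C * r ^ (-n).toNat

lemma exists_norm_le_of_tendsto {f : ℕ → ℂ} {L : ℂ} (h : Tendsto f atTop (𝓝 L)) :
    ∃ C, 0 ≤ C ∧ ∀ n, ‖f n‖ ≤ C := by
  obtain ⟨C, hC⟩ := h.norm.bddAbove_range
  exact ⟨C, (norm_nonneg _).trans (hC ⟨0, rfl⟩), fun n => hC ⟨n, rfl⟩⟩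

lemma TailBounded.of_tendsto {c : ℤ → ℂ} {L M b : ℂ} (hb : b ≠ 0)
    (h1 : Tendsto (fun n : ℕ => c n) atTop (𝓝 L))
    (h2 : Tendsto (fun n : ℕ => c (-n) * b ^ n) atTop (𝓝 M)) : TailBounded c := by
  obtain ⟨C1, hC1, h1⟩ := exists_norm_le_of_tendsto h1
  obtain ⟨C2, hC2, h2⟩ := exists_norm_le_of_tendsto h2
  refine ⟨max C1 C2, max ‖b‖⁻¹ 1, le_max_right _ _, fun n => ?_⟩
  obtain ⟨k, rfl | rfl⟩ := n.eq_nat_or_neg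
  · simpa using Or.inl (h1 k)
  · have h := h2 k
    rw [norm_mul, norm_pow, ← le_div_iff₀ (by positivity), div_eq_mul_inv, ← inv_pow] at h
    rw [neg_neg, Int.toNat_natCast]
    refine h.trans ?_
    gcongr
    · exact le_max_right _ _
    · exact le_max_left _ _

lemma summable_of_quadratic_ratio {f : ℕ → ℝ} {K Q : ℝ} (hQ0 : 0 ≤ Q) (hQ : Q < 1)
    (h : ∀ n, f (n + 1) = K * Q ^ n * f n) : Summable f := by
  have ht : Tendsto (fun n : ℕ => |K| * Q ^ n) atTop (𝓝 0) := by
    simpa using (tendsto_pow_atTop_nhds_zero_of_lt_one hQ0 hQ).const_mul |K|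
  refine summable_of_ratio_norm_eventually_le (r := 1 / 2) (by norm_num) ?_
  filter_upwards [ht.eventually_le_const (show (0 : ℝ) < 1 / 2 by norm_num)] with n hn
  rw [h, norm_mul, norm_mul, Real.norm_eq_abs K, Real.norm_of_nonneg (pow_nonneg hQ0 n)]
  gcongr

lemma summable_thetaCoeff {q z : ℂ} (hq : ‖q‖ < 1) (hq0 : q ≠ 0) (hz : z ≠ 0) (r : ℝ) :
    Summable fun n : ℤ => r ^ (-n).toNat * ‖thetaCoeff q n‖ * ‖z‖ ^ n := by
  have hz' : ‖z‖ ≠ 0 := norm_ne_zero_iff.2 hz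
  refine Summable.of_nat_of_neg
    (summable_of_quadratic_ratio (K := ‖q‖ * ‖z‖) (norm_nonneg q) hq fun n => ?_)
    (summable_of_quadratic_ratio (K := r * ‖z‖⁻¹) (norm_nonneg q) hq fun n => ?_)
  · have e1 : (-((n + 1 : ℕ) : ℤ)).toNat = 0 := by omega
    have e2 : (-(n : ℤ)).toNat = 0 := by omega
    rw [e1, e2]
    push_cast
    rw [thetaCoeff_succ hq0, zpow_add_one₀ hz', norm_mul, norm_neg, norm_zpow,
      zpow_add_one₀ (norm_ne_zero_iff.2 hq0), zpow_natCast, zpow_natCast]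
    ring
  · rw [thetaCoeff_neg_succ hq0, neg_neg, neg_neg, Int.toNat_natCast, Int.toNat_natCast, norm_mul,
      norm_neg, norm_pow, zpow_neg, zpow_neg, zpow_natCast, zpow_natCast]
    field_simp
    ring

lemma TailBounded.summable {c : ℤ → ℂ} (hc : TailBounded c) {q z : ℂ} (hq : ‖q‖ < 1)
    (hq0 : q ≠ 0) (hz : z ≠ 0) : Summable fun n : ℤ => c n * thetaCoeff q n * z ^ n := by
  obtain ⟨C, r, hr, h⟩ := hc
  refine Summable.of_norm_bounded ((summable_thetaCoeff hq hq0 hz r).mul_left C) fun n => ?_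
  rw [norm_mul, norm_mul, norm_zpow, ← mul_assoc, ← mul_assoc]
  gcongr
  exact h n

lemma bilat_recurrence {c : ℤ → ℂ} (hc : TailBounded c) {q z A B : ℂ} (hq : ‖q‖ < 1)
    (hq0 : q ≠ 0) (hz : z ≠ 0)
    (h : ∀ n : ℤ, (1 - A * q ^ (n + 1)) * c (n + 1) = (1 - B * q ^ (n + 1)) * c n) :
    bilat c q z - A * bilat c q (q * z) + q * z * bilat c q (q * z)
      - B * q ^ 2 * z * bilat c q (q ^ 2 * z) = 0 := by
  have h0 := (hc.summable hq hq0 hz).hasSum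
  have h1 := (hc.summable hq hq0 (mul_ne_zero hq0 hz)).hasSum
  have h2 := (hc.summable hq hq0 (mul_ne_zero (pow_ne_zero 2 hq0) hz)).hasSum
  have hl := (Equiv.addRight (1 : ℤ)).hasSum_iff.2 (h0.sub (h1.mul_left A))
  have hr := (h1.mul_left (q * z)).sub (h2.mul_left (B * q ^ 2 * z))
  have : bilat c q z - A * bilat c q (q * z)
      = -(q * z * bilat c q (q * z) - B * q ^ 2 * z * bilat c q (q ^ 2 * z)) := by
    refine hl.unique (hr.neg.congr_fun fun n => ?_)
    simp only [Function.comp, Equiv.coe_addRight, thetaCoeff_succ hq0, mul_zpow,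
      zpow_add_one₀ hz, ← zpow_natCast, ← zpow_mul]
    have e : q ^ (((2 : ℕ) : ℤ) * n) = q ^ n * q ^ n := by
      rw [← zpow_add₀ hq0]; congr 1; push_cast; ring
    have h' := h n
    rw [e]
    rw [zpow_add_one₀ hq0] at h' ⊢
    norm_cast
    linear_combination (-(q ^ n * q * z ^ n * z * thetaCoeff q n)) * h'
  linear_combination this

lemma tendsto_bilat_mul_zpow_neg {c : ℤ → ℂ} (hc : TailBounded c) {L : ℂ}
    (hL : Tendsto (fun n : ℕ => c n) atTop (𝓝 L)) {q v : ℂ} (hq : ‖q‖ < 1) (hq0 : q ≠ 0)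
    (hv : v ≠ 0) :
    Tendsto (fun N : ℕ => thetaCoeff q (-N) * (v ^ N)⁻¹ * bilat c q (v / q ^ N)) atTop
      (𝓝 (L * bilat 1 q v)) := by
  obtain ⟨C, r, hr, h⟩ := hc
  have hC : 0 ≤ C := by simpa using (norm_nonneg _).trans (h 0)
  have key : ∀ N : ℕ, thetaCoeff q (-N) * (v ^ N)⁻¹ * bilat c q (v / q ^ N)
      = ∑' m : ℤ, c (m + N) * (thetaCoeff q m * v ^ m) := fun N => by
    rw [bilat, ← tsum_mul_left, ← (Equiv.addRight (N : ℤ)).tsum_eq]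
    refine tsum_congr fun m => ?_
    have h1 := thetaCoeff_neg_mul_self hq0 N
    rw [Equiv.coe_addRight, thetaCoeff_add hq0, div_zpow, zpow_add₀ hv, zpow_natCast,
      ← zpow_natCast q N, ← zpow_mul, mul_add, zpow_add₀ hq0, ← h1, mul_comm (N : ℤ) m]
    have := thetaCoeff_ne_zero hq0 N
    have := thetaCoeff_ne_zero hq0 (-N)
    have := zpow_ne_zero (m * N) hq0
    field_simp
  have hlim : L * bilat 1 q v = ∑' m : ℤ, L * (thetaCoeff q m * v ^ m) := by
    rw [bilat, ← tsum_mul_left]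
    simp
  simp only [key]
  rw [hlim]
  refine tendsto_tsum_of_dominated_convergence
    (bound := fun m : ℤ => C * (r ^ (-m).toNat * ‖thetaCoeff q m‖ * ‖v‖ ^ m))
    ((summable_thetaCoeff hq hq0 hv r).mul_left C) (fun m => ?_)
    (Eventually.of_forall fun N m => ?_)
  · refine Tendsto.mul_const _ ?_
    have h1 : Tendsto (fun N : ℕ => (m + N).toNat) atTop atTop := by
      refine tendsto_atTop.2 fun k => ?_
      filter_upwards [eventually_ge_atTop (k + m.natAbs)] with N hN
      omega
    refine (hL.comp h1).congr' ?_
    filter_upwards [eventually_ge_atTop m.natAbs] with N hN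
    simp only [Function.comp]
    congr 1
    omega
  · rw [norm_mul, norm_mul, norm_zpow]
    rw [mul_assoc (r ^ _), ← mul_assoc C]
    gcongr
    refine (h _).trans ?_
    gcongr C * r ^ ?_
    omega

/-! ### The series `∑ (qb;q)_n / (q;q)_n (-1)^n q^{n(n+1)/2} z^n` -/

/-- The coefficient `(qb;q)_n / (q;q)_n`, extended by zero to negative indices. -/
def ratioCoeff (b q : ℂ) (n : ℤ) : ℂ :=
  if 0 ≤ n then qpn (q * b) q n.toNat / qpn q q n.toNat else 0

lemma mul_pow_ne_one {q : ℂ} (hq : ‖q‖ < 1) (j : ℕ) : q * q ^ j ≠ 1 := fun h => by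
  have h1 : ‖q ^ (j + 1)‖ < 1 := by
    rw [norm_pow]; exact pow_lt_one₀ (norm_nonneg _) hq (Nat.succ_ne_zero _)
  rw [pow_succ', h, norm_one] at h1
  exact lt_irrefl _ h1

lemma ratioCoeff_natCast (b q : ℂ) (n : ℕ) : ratioCoeff b q n = qpn (q * b) q n / qpn q q n := by
  simp [ratioCoeff]

lemma ratioCoeff_of_neg (b q : ℂ) {n : ℤ} (h : n < 0) : ratioCoeff b q n = 0 := by
  simp [ratioCoeff, h]

lemma tendsto_ratioCoeff {q : ℂ} (hq : ‖q‖ < 1) (b : ℂ) :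
    Tendsto (fun n : ℕ => ratioCoeff b q n) atTop (𝓝 (qpinf (q * b) q / qpinf q q)) := by
  simp only [ratioCoeff_natCast]
  exact (tendsto_qpn hq _).div (tendsto_qpn hq _) (qpinf_ne_zero hq (mul_pow_ne_one hq))

lemma tailBounded_ratioCoeff {q : ℂ} (hq : ‖q‖ < 1) (b : ℂ) : TailBounded (ratioCoeff b q) := by
  refine .of_tendsto one_ne_zero (tendsto_ratioCoeff hq b)
    (tendsto_const_nhds (x := (0 : ℂ)).congr' ?_)
  filter_upwards [eventually_ge_atTop 1] with n hn
  rw [ratioCoeff_of_neg _ _ (by omega), zero_mul]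

lemma ratioCoeff_succ {q : ℂ} (hq : ‖q‖ < 1) (hq0 : q ≠ 0) (b : ℂ) (n : ℤ) :
    (1 - 1 * q ^ (n + 1)) * ratioCoeff b q (n + 1)
      = (1 - b * q ^ (n + 1)) * ratioCoeff b q n := by
  obtain h | rfl | h : n < -1 ∨ n = -1 ∨ 0 ≤ n := by omega
  · rw [ratioCoeff_of_neg _ _ (by omega), ratioCoeff_of_neg _ _ (by omega)]; simp
  · rw [ratioCoeff_of_neg b q (n := -1) (by omega)]; simp
  · lift n to ℕ using h
    have h1 := qpn_ne_zero (mul_pow_ne_one hq) n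
    have h2 := sub_ne_zero.2 (mul_pow_ne_one hq n).symm
    have h3 := ratioCoeff_natCast b q (n + 1)
    push_cast at h3
    rw [h3, ratioCoeff_natCast, qpn_succ, qpn_succ, zpow_add_one₀ hq0, zpow_natCast,
      one_mul, mul_comm (q ^ n) q]
    field_simp

lemma bilat_ratioCoeff_recurrence {q : ℂ} (hq : ‖q‖ < 1) (hq0 : q ≠ 0) (b : ℂ) {z : ℂ}
    (hz : z ≠ 0) :
    bilat (ratioCoeff b q) q z - bilat (ratioCoeff b q) q (q * z)
      + q * z * bilat (ratioCoeff b q) q (q * z)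
      - b * q ^ 2 * z * bilat (ratioCoeff b q) q (q ^ 2 * z) = 0 := by
  simpa using bilat_recurrence (tailBounded_ratioCoeff hq b) hq hq0 hz (ratioCoeff_succ hq hq0 b)

lemma tendsto_bilat_ratioCoeff {q : ℂ} (hq : ‖q‖ < 1) (hq0 : q ≠ 0) (b : ℂ) {z : ℂ} (hz : z ≠ 0) :
    Tendsto (fun N : ℕ => bilat (ratioCoeff b q) q (z * q ^ N)) atTop (𝓝 1) := by
  have h1 : (1 : ℂ) = ∑' n : ℤ, if n = 0 then 1 else 0 :=
    (tsum_ite_eq 0 (fun _ => (1 : ℂ))).symm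
  rw [h1]
  refine tendsto_tsum_of_dominated_convergence
    ((tailBounded_ratioCoeff hq b).summable hq hq0 hz).norm (fun n => ?_)
    (Eventually.of_forall fun N n => ?_)
  · obtain h | rfl | h := lt_trichotomy n 0
    · simp [ratioCoeff_of_neg _ _ h, h.ne]
    · simp [ratioCoeff, qpn, thetaCoeff_zero]
    · rw [if_neg h.ne']
      lift n to ℕ using h.le
      have hn : n ≠ 0 := by rintro rfl; simp at h
      have : Tendsto (fun N : ℕ => (q ^ n) ^ N) atTop (𝓝 0) :=
        tendsto_pow_atTop_nhds_zero_of_norm_lt_one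
          (by rw [norm_pow]; exact pow_lt_one₀ (norm_nonneg _) hq hn)
      have := this.const_mul (ratioCoeff b q n * thetaCoeff q n * z ^ n)
      rw [mul_zero] at this
      refine this.congr fun N => ?_
      rw [zpow_natCast, mul_pow, ← pow_mul, ← pow_mul, mul_comm n N]
      ring
  · obtain h | h := lt_or_ge n 0
    · simp [ratioCoeff_of_neg _ _ h]
    · lift n to ℕ using h
      rw [norm_mul, norm_mul (_ * _) (z ^ (n : ℤ))]
      gcongr
      rw [zpow_natCast, zpow_natCast, norm_pow, norm_pow, norm_mul, norm_pow]
      gcongr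
      exact mul_le_of_le_one_right (norm_nonneg _) (pow_le_one₀ (norm_nonneg _) hq.le)

lemma bilat_ratioCoeff_zero {q : ℂ} (hq : ‖q‖ < 1) (hq0 : q ≠ 0) {z : ℂ} (hz : z ≠ 0) :
    bilat (ratioCoeff 0 q) q z = qpinf (q * z) q := by
  have key : ∀ N : ℕ, bilat (ratioCoeff 0 q) q z
      = qpn (q * z) q N * bilat (ratioCoeff 0 q) q (z * q ^ N) := fun N => by
    induction N with
    | zero => simp [qpn]
    | succ N ih =>
      have h := bilat_ratioCoeff_recurrence hq hq0 0 (mul_ne_zero hz (pow_ne_zero N hq0))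
      have e : q * (z * q ^ N) = z * q ^ (N + 1) := by ring
      rw [e] at h
      rw [ih, qpn_succ]
      linear_combination qpn (q * z) q N * h
  have h := (tendsto_qpn hq (q * z)).mul (tendsto_bilat_ratioCoeff hq hq0 0 hz)
  rw [mul_one] at h
  exact tendsto_nhds_unique (tendsto_const_nhds.congr key) h

/-- The Jacobi triple product identity. -/
lemma bilat_one {q : ℂ} (hq : ‖q‖ < 1) (hq0 : q ≠ 0) {v : ℂ} (hv : v ≠ 0) :
    bilat 1 q v = qpinf q q * qtheta q (q * v) := by
  have h1 := tendsto_bilat_mul_zpow_neg (tailBounded_ratioCoeff hq 0) (tendsto_ratioCoeff hq 0)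
    hq hq0 hv
  have key : ∀ N : ℕ, thetaCoeff q (-N) * (v ^ N)⁻¹ * bilat (ratioCoeff 0 q) q (v / q ^ N)
      = qpn (1 / v) q N * qpinf (q * v) q := fun N => by
    rw [bilat_ratioCoeff_zero hq hq0 (div_ne_zero hv (pow_ne_zero _ hq0))]
    induction N with
    | zero => simp [qpn, thetaCoeff_zero]
    | succ N ih =>
      rw [qpinf_eq_one_sub_mul hq, thetaCoeff_neg_succ hq0, qpn_succ]
      have e : q * (v / q ^ (N + 1)) * q = q * (v / q ^ N) := by
        rw [pow_succ]; field_simp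
      rw [e, mul_right_comm (qpn _ _ _), ← ih, pow_succ, pow_succ]
      field_simp
      ring_nf
  simp only [key] at h1
  have h2 := (tendsto_qpn hq (1 / v)).mul_const (qpinf (q * v) q)
  have h := tendsto_nhds_unique h1 h2
  have h3 := qpinf_ne_zero hq (mul_pow_ne_one hq)
  have e : q / (q * v) = 1 / v := by field_simp
  have h4 : qpinf (q * 0) q = 1 := by simp [qpinf]
  rw [h4] at h
  rw [qtheta, e]
  field_simp at h
  rw [h]; ring_nf

/-! ### The `₀φ₁` series -/

lemma eq_zero_of_recurrence {q : ℂ} (hq : ‖q‖ < 1) {d : ℕ → ℂ} (s t : ℂ)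
    (h : ∀ n, d n = (1 - s * q ^ n) * d (n + 1) + t * q ^ n * d (n + 2))
    (hd : Tendsto d atTop (𝓝 0)) : d 0 = 0 := by
  set ε : ℕ → ℝ := fun n => (‖s‖ + ‖t‖) * ‖q‖ ^ n with hε
  have hε0 : ∀ n, 0 ≤ ε n := fun n => by positivity
  set m : ℕ → ℝ := fun n => max ‖d n‖ ‖d (n + 1)‖ with hm
  have hm0 : ∀ n, 0 ≤ m n := fun n => le_max_of_le_left (norm_nonneg _)
  have step : ∀ n, m n ≤ (1 + ε n) * m (n + 1) := fun n => by
    have h1 : ‖d (n + 1)‖ ≤ m (n + 1) := le_max_left _ _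
    have h2 : ‖d (n + 2)‖ ≤ m (n + 1) := le_max_right _ _
    refine max_le ?_ (h1.trans (le_mul_of_one_le_left (hm0 _) (by linarith [hε0 n])))
    calc ‖d n‖ ≤ (1 + ‖s‖ * ‖q‖ ^ n) * ‖d (n + 1)‖ + ‖t‖ * ‖q‖ ^ n * ‖d (n + 2)‖ := by
          rw [h n]
          refine (norm_add_le _ _).trans ?_
          rw [norm_mul, norm_mul, norm_mul, norm_pow]
          gcongr
          refine (norm_sub_le _ _).trans ?_
          simp
      _ ≤ (1 + ‖s‖ * ‖q‖ ^ n) * m (n + 1) + ‖t‖ * ‖q‖ ^ n * m (n + 1) := by gcongr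
      _ = (1 + ε n) * m (n + 1) := by rw [hε]; ring
  have key : ∀ N, m 0 ≤ (∏ j ∈ Finset.range N, (1 + ε j)) * m N := fun N => by
    induction N with
    | zero => simp
    | succ N ih =>
      rw [Finset.prod_range_succ, mul_assoc]
      exact ih.trans (mul_le_mul_of_nonneg_left (step N)
        (Finset.prod_nonneg fun j _ => by linarith [hε0 j]))
  have hs : Summable ε := (summable_geometric_of_lt_one (norm_nonneg q) hq).mul_left _
  have hp := (Real.multipliable_one_add_of_summable hs).tendsto_prod_tprod_nat
  have hmt : Tendsto m atTop (𝓝 0) := by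
    simpa using hd.norm.max ((tendsto_add_atTop_iff_nat 1).2 hd).norm
  have hl := ge_of_tendsto' (hp.mul hmt) key
  rw [mul_zero] at hl
  exact norm_le_zero_iff.1 ((le_max_left _ _).trans hl)

/-- The summand of `(c;q)_∞ ₀φ₁(—; c; q, cqb)`. -/
def phiTerm (b q c : ℂ) (n : ℕ) : ℂ :=
  q ^ (n * (n - 1)) * (c * q * b) ^ n * qpinf (c * q ^ n) q / qpn q q n

lemma phiTerm_bound {q : ℂ} (hq : ‖q‖ < 1) (b c : ℂ) :
    ∃ g : ℕ → ℝ, Summable g ∧ ∀ N n, ‖phiTerm b q (c * q ^ N) n‖ ≤ g n := by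
  obtain ⟨M, hM, h1⟩ := exists_norm_le_of_tendsto (tendsto_qpinf_mul_pow hq c)
  obtain ⟨P, hP, h2⟩ := exists_norm_le_of_tendsto
    ((tendsto_qpn hq q).inv₀ (qpinf_ne_zero hq (mul_pow_ne_one hq)))
  refine ⟨fun n => P * M * (‖q‖ ^ (n * (n - 1)) * ‖c * q * b‖ ^ n),
    Summable.mul_left _ (summable_of_quadratic_ratio (K := ‖c * q * b‖) (Q := ‖q‖ ^ 2)
      (by positivity) (pow_lt_one₀ (norm_nonneg _) hq two_ne_zero) fun n => ?_), fun N n => ?_⟩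
  · have e : (n + 1) * (n + 1 - 1) = n * (n - 1) + 2 * n := by
      cases n with
      | zero => rfl
      | succ k => simp only [Nat.add_sub_cancel]; ring
    rw [e, pow_add, pow_mul, pow_succ]
    ring
  · have e : c * q ^ N * q ^ n = c * q ^ (N + n) := by ring
    rw [phiTerm, div_eq_mul_inv, e, norm_mul, norm_mul, norm_mul, norm_pow, norm_pow]
    have h3 : ‖c * q ^ N * q * b‖ ≤ ‖c * q * b‖ := by
      have : c * q ^ N * q * b = c * q * b * q ^ N := by ring
      rw [this, norm_mul, norm_pow]
      exact mul_le_of_le_one_right (norm_nonneg _) (pow_le_one₀ (norm_nonneg _) hq.le)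
    calc _ ≤ ‖q‖ ^ (n * (n - 1)) * ‖c * q * b‖ ^ n * M * P := by
          gcongr
          · exact h1 _
          · exact h2 n
      _ = _ := by ring

lemma summable_phiTerm {q : ℂ} (hq : ‖q‖ < 1) (b c : ℂ) : Summable (phiTerm b q c) := by
  obtain ⟨g, hg, h⟩ := phiTerm_bound hq b c
  exact Summable.of_norm_bounded hg fun n => by simpa using h 0 n

lemma tsum_phiTerm_recurrence {q : ℂ} (hq : ‖q‖ < 1) (b c : ℂ) :
    ∑' n, phiTerm b q c n = (1 - c) * ∑' n, phiTerm b q (c * q) n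
      + c * q * b * ∑' n, phiTerm b q (c * q ^ 2) n := by
  have h0 := (summable_phiTerm hq b c).hasSum
  have h1 := (summable_phiTerm hq b (c * q)).hasSum
  have h2 := (summable_phiTerm hq b (c * q ^ 2)).hasSum
  have hl := h0.sub (h1.mul_left (1 - c))
  have hn : ∀ n, phiTerm b q c n - (1 - c) * phiTerm b q (c * q) n
      = q ^ (n * (n - 1)) * (c * q * b) ^ n * qpinf (c * q * q ^ n) q / qpn q q n
        * (1 - q ^ n) := fun n => by
    have e : c * q ^ n * q = c * q * q ^ n := by ring
    have e' : (c * q * q * b) ^ n = (c * q * b) ^ n * q ^ n := by rw [← mul_pow]; ring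
    rw [phiTerm, phiTerm, qpinf_eq_one_sub_mul hq (c * q ^ n), e, e']
    ring
  rw [← hasSum_nat_add_iff' 1] at hl
  simp only [hn, Finset.range_one, Finset.sum_singleton, pow_zero, sub_self, mul_zero,
    sub_zero] at hl
  have := hl.unique ((h2.mul_left (c * q * b)).congr_fun fun n => ?_)
  · linear_combination this
  · have e : (n + 1) * (n + 1 - 1) = n * (n - 1) + 2 * n := by
      cases n with
      | zero => rfl
      | succ k => simp only [Nat.add_sub_cancel]; ring
    have e1 : c * q * q ^ (n + 1) = c * q ^ 2 * q ^ n := by ring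
    have e2 : (c * q ^ 2 * q * b) ^ n = (c * q * b) ^ n * q ^ (2 * n) := by
      rw [pow_mul, ← mul_pow]; ring
    have h3 := qpn_ne_zero (mul_pow_ne_one hq) n
    have h4 := sub_ne_zero.2 (mul_pow_ne_one hq n).symm
    rw [phiTerm, e, e1, e2, qpn_succ, pow_add, pow_succ (c * q * b), pow_succ' q n]
    field_simp

lemma tendsto_tsum_phiTerm {q : ℂ} (hq : ‖q‖ < 1) (b c : ℂ) :
    Tendsto (fun N : ℕ => ∑' n, phiTerm b q (c * q ^ N) n) atTop (𝓝 1) := by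
  obtain ⟨g, hg, h⟩ := phiTerm_bound hq b c
  have h1 : (1 : ℂ) = ∑' n : ℕ, if n = 0 then 1 else 0 :=
    (tsum_ite_eq 0 (fun _ => (1 : ℂ))).symm
  rw [h1]
  refine tendsto_tsum_of_dominated_convergence hg (fun n => ?_)
    (Eventually.of_forall fun N n => h N n)
  obtain rfl | hn := eq_or_ne n 0
  · simpa [phiTerm, qpn] using tendsto_qpinf_mul_pow hq c
  · rw [if_neg hn]
    have ht : Tendsto (fun N : ℕ => (q ^ n) ^ N) atTop (𝓝 0) :=
      tendsto_pow_atTop_nhds_zero_of_norm_lt_one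
        (by rw [norm_pow]; exact pow_lt_one₀ (norm_nonneg _) hq hn)
    have := (ht.mul (tendsto_qpinf_mul_pow hq (c * q ^ n))).const_mul
      (q ^ (n * (n - 1)) * (c * q * b) ^ n / qpn q q n)
    rw [zero_mul, mul_zero] at this
    refine this.congr fun N => ?_
    have e1 : (c * q ^ N * q * b) ^ n = (c * q * b) ^ n * (q ^ n) ^ N := by
      rw [← pow_mul, mul_comm n N, pow_mul, ← mul_pow]; ring
    have e2 : c * q ^ N * q ^ n = c * q ^ n * q ^ N := by ring
    rw [phiTerm, e1, e2]
    ring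

lemma tsum_phiTerm {q : ℂ} (hq : ‖q‖ < 1) (hq0 : q ≠ 0) (b : ℂ) {c : ℂ} (hc : c ≠ 0) :
    ∑' n, phiTerm b q c n = bilat (ratioCoeff b q) q (c / q) := by
  have h := eq_zero_of_recurrence hq (d := fun N : ℕ => ∑' n, phiTerm b q (c * q ^ N) n
    - bilat (ratioCoeff b q) q (c / q * q ^ N)) c (c * q * b) (fun N => ?_) ?_
  · simpa [sub_eq_zero] using h
  · have h1 := tsum_phiTerm_recurrence hq b (c * q ^ N)
    have h2 := bilat_ratioCoeff_recurrence hq hq0 b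
      (mul_ne_zero (div_ne_zero hc hq0) (pow_ne_zero N hq0))
    have e1 : c * q ^ N * q = c * q ^ (N + 1) := by ring
    have e2 : c * q ^ N * q ^ 2 = c * q ^ (N + 2) := by ring
    have e3 : q * (c / q * q ^ N) = c / q * q ^ (N + 1) := by ring
    have e4 : q ^ 2 * (c / q * q ^ N) = c / q * q ^ (N + 2) := by ring
    have e5 : c / q * q ^ (N + 1) = c * q ^ N := by rw [pow_succ']; field_simp
    have e6 : b * q ^ 2 * (c / q * q ^ N) = c * q * b * q ^ N := by field_simp
    rw [e1, e2] at h1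
    rw [e3, e4, e6] at h2
    linear_combination h1 - h2 + bilat (ratioCoeff b q) q (c / q * q ^ (N + 1)) * e5
  · simpa using (tendsto_tsum_phiTerm hq b c).sub
      (tendsto_bilat_ratioCoeff hq hq0 b (div_ne_zero hc hq0))

lemma qpinf_mul_phi01 {q : ℂ} (hq : ‖q‖ < 1) (hq0 : q ≠ 0) (b : ℂ) {c : ℂ} (hc : c ≠ 0)
    (hc' : ∀ m : ℕ, c * q ^ m ≠ 1) :
    qpinf c q * phi01 c q (c * q * b) = bilat (ratioCoeff b q) q (c / q) := by
  rw [← tsum_phiTerm hq hq0 b hc, phi01, ← tsum_mul_left]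
  refine tsum_congr fun n => ?_
  have := qpn_ne_zero hc' n
  rw [qpinf_eq_qpn_mul hq c n, phiTerm]
  field_simp

/-! ### Casoratians and the connection formula -/

lemma casoratian_eq {q w b L : ℂ} (hq : ‖q‖ < 1) (hq0 : q ≠ 0)
    {h f : ℕ → ℂ}
    (hh : ∀ n, h n + (w * q ^ (n + 1) - 1) * h (n + 1) - w * b * q ^ (n + 2) * h (n + 2) = 0)
    (hf : ∀ n, f n + (w * q ^ (n + 1) - 1) * f (n + 1) - w * b * q ^ (n + 2) * f (n + 2) = 0)
    (hlim : Tendsto h atTop (𝓝 1))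
    (flim : Tendsto (fun n : ℕ => thetaCoeff q (-n) * (q * w * b) ^ n * f n) atTop (𝓝 L)) :
    q * w * b * (h 0 * f 1 - h 1 * f 0) = -L := by
  set γ : ℕ → ℂ := fun n => thetaCoeff q (-n) * (q * w * b) ^ n with hγ
  have γ_succ : ∀ n, γ (n + 1) = -(q * w * b) * q ^ n * γ n := fun n => by
    simp only [hγ, thetaCoeff_neg_succ hq0, pow_succ]; ring
  have hinv : ∀ n, q ^ n * γ n * (h n * f (n + 1) - h (n + 1) * f n)
      = h 0 * f 1 - h 1 * f 0 := fun n => by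
    induction n with
    | zero => simp [hγ, thetaCoeff_zero]
    | succ n ih =>
      rw [← ih, γ_succ]
      linear_combination (-(q ^ n * γ n)) * (f (n + 1) * hh n - h (n + 1) * hf n)
  have hq' := tendsto_pow_atTop_nhds_zero_of_norm_lt_one hq
  have h1 := (hlim.mul ((tendsto_add_atTop_iff_nat 1).2 flim)).neg.sub
    (((((tendsto_add_atTop_iff_nat 1).2 hlim).mul flim).mul hq').const_mul (q * w * b))
  rw [mul_zero, mul_zero, sub_zero, one_mul] at h1
  refine tendsto_nhds_unique (tendsto_const_nhds.congr fun n => ?_) h1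
  have e := γ_succ n
  simp only [hγ] at e
  rw [e, ← hinv n]
  simp only [hγ]
  ring

/-- The coefficient `(xq^{n+1};q)_∞ / (xbq^{n+1};q)_∞` of the `μ`-function. -/
def muCoeff (x b q : ℂ) (n : ℤ) : ℂ :=
  qpinf (x * q ^ (n + 1)) q / qpinf (x * b * q ^ (n + 1)) q

lemma qpinf_zpow_ne_zero {q : ℂ} (hq : ‖q‖ < 1) (hq0 : q ≠ 0) {x : ℂ}
    (hx : ∀ m : ℤ, x ≠ q ^ m) (n : ℤ) : qpinf (x * q ^ n) q ≠ 0 := by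
  refine qpinf_ne_zero hq fun j hj => hx (-(n + j)) ?_
  rw [zpow_neg, zpow_add₀ hq0, zpow_natCast]
  exact eq_inv_of_mul_eq_one_left (by rw [← hj]; ring)

lemma one_sub_mul_zpow_ne_zero {q x : ℂ} (hx : ∀ m : ℤ, x ≠ q ^ m) (n : ℤ) :
    1 - x * q ^ n ≠ 0 := fun h => hx (-n) <| by
  rw [zpow_neg]; exact eq_inv_of_mul_eq_one_left (sub_eq_zero.1 h).symm

lemma muCoeff_succ {q : ℂ} (hq : ‖q‖ < 1) (hq0 : q ≠ 0) {x b : ℂ}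
    (hxb : ∀ m : ℤ, x * b ≠ q ^ m) (n : ℤ) :
    (1 - x * q ^ (n + 1)) * muCoeff x b q (n + 1)
      = (1 - x * b * q ^ (n + 1)) * muCoeff x b q n := by
  have h1 := qpinf_zpow_ne_zero hq hq0 hxb (n + 1)
  have h2 := qpinf_zpow_ne_zero hq hq0 hxb (n + 1 + 1)
  have h3 := qpinf_eq_one_sub_mul hq (x * q ^ (n + 1))
  have h4 := qpinf_eq_one_sub_mul hq (x * b * q ^ (n + 1))
  rw [mul_assoc _ (q ^ (n + 1)), ← zpow_add_one₀ hq0] at h3 h4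
  have h5 := one_sub_mul_zpow_ne_zero hxb (n + 1)
  rw [muCoeff, muCoeff, h3, h4, mul_div_mul_comm, ← mul_assoc, mul_div_cancel₀ _ h5]

lemma tendsto_muCoeff {q : ℂ} (hq : ‖q‖ < 1) (hq0 : q ≠ 0) (x b : ℂ) :
    Tendsto (fun n : ℕ => muCoeff x b q n) atTop (𝓝 1) := by
  have h := (tendsto_qpinf_mul_pow hq (x * q)).div (tendsto_qpinf_mul_pow hq (x * b * q))
    one_ne_zero
  rw [div_one] at h
  refine h.congr fun n => ?_
  simp only [Pi.div_apply, muCoeff, zpow_add_one₀ hq0, zpow_natCast]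
  ring_nf

lemma tendsto_muCoeff_neg {q : ℂ} (hq : ‖q‖ < 1) (hq0 : q ≠ 0) {x b : ℂ} (hx0 : x ≠ 0)
    (hb : b ≠ 0) (hxb : ∀ m : ℤ, x * b ≠ q ^ m) :
    Tendsto (fun n : ℕ => muCoeff x b q (-n) * b ^ n) atTop
      (𝓝 (qtheta q (q * x) / qtheta q (q * (x * b)))) := by
  have hne : ∀ j : ℕ, 1 / (x * b) * q ^ j ≠ 1 := fun j hj => hxb j (by
    rw [zpow_natCast]; field_simp at hj; exact hj.symm)
  have h := ((tendsto_qpn hq (1 / x)).div (tendsto_qpn hq (1 / (x * b)))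
    (qpinf_ne_zero hq hne)).const_mul (muCoeff x b q 0)
  have e : qtheta q (q * x) / qtheta q (q * (x * b))
      = muCoeff x b q 0 * (qpinf (1 / x) q / qpinf (1 / (x * b)) q) := by
    have e1 : q / (q * x) = 1 / x := by field_simp
    have e2 : q / (q * (x * b)) = 1 / (x * b) := by field_simp
    rw [qtheta, qtheta, muCoeff, e1, e2, zero_add, zpow_one, mul_comm q x, mul_comm q (x * b)]
    rw [mul_div_mul_comm]
  rw [e]
  refine h.congr fun n => ?_
  simp only [Pi.div_apply]
  induction n with
  | zero => simp [qpn]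
  | succ n ih =>
    have h1 := muCoeff_succ hq hq0 hxb (-((n + 1 : ℕ) : ℤ))
    have e1 : -((n + 1 : ℕ) : ℤ) + 1 = -n := by push_cast; ring
    have h2 := one_sub_mul_zpow_ne_zero hxb (-n)
    rw [e1] at h1
    rw [zpow_neg, zpow_natCast] at h1 h2
    have h3 : muCoeff x b q (-((n + 1 : ℕ) : ℤ))
        = (1 - x * (q ^ n)⁻¹) * muCoeff x b q (-n) / (1 - x * b * (q ^ n)⁻¹) := by
      rw [h1, mul_div_cancel_left₀ _ h2]
    have h4 := qpn_ne_zero hne n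
    have h5 : 1 - 1 / (x * b) * q ^ n ≠ 0 := sub_ne_zero.2 (hne n).symm
    have hqn := pow_ne_zero n hq0
    have h6 : (1 - x * (q ^ n)⁻¹) / (1 - x * b * (q ^ n)⁻¹) * b
        = (1 - 1 / x * q ^ n) / (1 - 1 / (x * b) * q ^ n) := by
      rw [eq_div_iff h5, div_mul_eq_mul_div, div_mul_eq_mul_div, div_eq_iff h2]
      field_simp
      ring
    calc _ = muCoeff x b q 0 * (qpn (1 / x) q n / qpn (1 / (x * b)) q n)
            * ((1 - 1 / x * q ^ n) / (1 - 1 / (x * b) * q ^ n)) := by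
          rw [qpn_succ, qpn_succ]; field_simp
      _ = _ := by rw [ih, ← h6, h3, pow_succ]; ring

lemma bilat_reflect {c : ℤ → ℂ} {q b z : ℂ} (hq0 : q ≠ 0) (hb : b ≠ 0) (hz : z ≠ 0) :
    bilat (fun n => c (-n) * b ^ n) q (1 / (q * b * z)) = bilat c q z := by
  rw [bilat, bilat, ← (Equiv.neg ℤ).tsum_eq]
  refine tsum_congr fun n => ?_
  have h : thetaCoeff q (-n) = thetaCoeff q n * (q ^ n)⁻¹ := by
    have e : -n * (-n + 1) / 2 = n * (n + 1) / 2 - n := by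
      have h1 := Int.ediv_mul_cancel (Int.even_mul_succ_self n).two_dvd
      have h2 := Int.ediv_mul_cancel (Int.even_mul_succ_self (-n)).two_dvd
      linarith
    rw [thetaCoeff, thetaCoeff, e, zpow_sub₀ hq0, zpow_neg, ← inv_zpow]
    norm_num
    ring
  have h1 := zpow_ne_zero n hq0
  have h2 := zpow_ne_zero n hb
  rw [Equiv.neg_apply, neg_neg, h, one_div, inv_zpow, zpow_neg, zpow_neg, inv_inv, mul_zpow,
    mul_zpow]
  field_simp

lemma bilat_muCoeff_recurrence {q : ℂ} (hq : ‖q‖ < 1) (hq0 : q ≠ 0) {x b z : ℂ} (hx0 : x ≠ 0)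
    (hb : b ≠ 0) (hz : z ≠ 0) (hxb : ∀ m : ℤ, x * b ≠ q ^ m) :
    bilat (muCoeff x b q) q z - x * bilat (muCoeff x b q) q (q * z)
      + q * z * bilat (muCoeff x b q) q (q * z)
      - x * b * q ^ 2 * z * bilat (muCoeff x b q) q (q ^ 2 * z) = 0 :=
  bilat_recurrence (.of_tendsto hb (tendsto_muCoeff hq hq0 x b)
    (tendsto_muCoeff_neg hq hq0 hx0 hb hxb)) hq hq0 hz (muCoeff_succ hq hq0 hxb)

lemma tendsto_bilat_muCoeff_zero {q : ℂ} (hq : ‖q‖ < 1) (hq0 : q ≠ 0) {x b y : ℂ} (hx0 : x ≠ 0)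
    (hb : b ≠ 0) (hy : y ≠ 0) (hxb : ∀ m : ℤ, x * b ≠ q ^ m) :
    Tendsto (fun N : ℕ => thetaCoeff q (-N) * (q * b * y) ^ N
        * bilat (muCoeff x b q) q (y * q ^ N)) atTop
      (𝓝 (qtheta q (q * x) / qtheta q (q * (x * b)) * bilat 1 q (1 / (q * b * y)))) := by
  have h1 := tendsto_muCoeff hq hq0 x b
  have h2 := tendsto_muCoeff_neg hq hq0 hx0 hb hxb
  have hlim : Tendsto (fun n : ℕ => (fun n : ℤ => muCoeff x b q (-n) * b ^ n) n) atTop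
      (𝓝 (qtheta q (q * x) / qtheta q (q * (x * b)))) :=
    h2.congr fun n => by simp
  have hc : TailBounded fun n => muCoeff x b q (-n) * b ^ n := by
    refine .of_tendsto hb hlim (h1.congr fun n => ?_)
    rw [neg_neg, zpow_neg, zpow_natCast, inv_mul_cancel_right₀ (pow_ne_zero n hb)]
  have hv : 1 / (q * b * y) ≠ 0 := one_div_ne_zero (mul_ne_zero (mul_ne_zero hq0 hb) hy)
  refine (tendsto_bilat_mul_zpow_neg hc hlim hq hq0 hv).congr fun N => ?_
  rw [← bilat_reflect hq0 hb (mul_ne_zero hy (pow_ne_zero N hq0)), one_div, inv_pow, inv_inv]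
  congr 2
  field_simp

/-- The connection formula between the bilateral series and the two unilateral ones. -/
lemma bilat_muCoeff_connection {q : ℂ} (hq : ‖q‖ < 1) (hq0 : q ≠ 0) {x b y : ℂ} (hx0 : x ≠ 0)
    (hb : b ≠ 0) (hy : y ≠ 0) (hxb : ∀ m : ℤ, x * b ≠ q ^ m) :
    bilat (muCoeff x b q) q y * (x / y) * (qpinf (q * b) q / qpinf q q * bilat 1 q (x / y))
      = bilat (ratioCoeff b q) q (x / y) * (x / y)
          * (qtheta q (q * x) / qtheta q (q * (x * b)) * bilat 1 q (1 / (q * b * y)))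
        - bilat (ratioCoeff b q) q (y / x) * bilat 1 q y := by
  have hrec : ∀ {w : ℂ}, w ≠ 0 → ∀ n : ℕ, bilat (ratioCoeff b q) q (w * q ^ n)
      + (w * q ^ (n + 1) - 1) * bilat (ratioCoeff b q) q (w * q ^ (n + 1))
      - w * b * q ^ (n + 2) * bilat (ratioCoeff b q) q (w * q ^ (n + 2)) = 0 := fun {w} hw n => by
    have h := bilat_ratioCoeff_recurrence hq hq0 b (mul_ne_zero hw (pow_ne_zero n hq0))
    have e1 : q * (w * q ^ n) = w * q ^ (n + 1) := by ring
    have e2 : q ^ 2 * (w * q ^ n) = w * q ^ (n + 2) := by ring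
    rw [e1, e2] at h
    linear_combination h
  have hw : y / x ≠ 0 := div_ne_zero hy hx0
  have hw' : x / y ≠ 0 := div_ne_zero hx0 hy
  have hk : ∀ n : ℕ, (1 / (q * b)) ^ n * bilat (ratioCoeff b q) q (x / y / q ^ n)
      + (y / x * q ^ (n + 1) - 1)
        * ((1 / (q * b)) ^ (n + 1) * bilat (ratioCoeff b q) q (x / y / q ^ (n + 1)))
      - y / x * b * q ^ (n + 2)
        * ((1 / (q * b)) ^ (n + 2) * bilat (ratioCoeff b q) q (x / y / q ^ (n + 2))) = 0 :=
    fun n => by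
      have h := bilat_ratioCoeff_recurrence hq hq0 b (div_ne_zero hw' (pow_ne_zero (n + 2) hq0))
      have e1 : q * (x / y / q ^ (n + 2)) = x / y / q ^ (n + 1) := by
        rw [pow_succ q (n + 1)]; field_simp
      have e2 : q ^ 2 * (x / y / q ^ (n + 2)) = x / y / q ^ n := by
        rw [pow_add]; field_simp
      rw [e1, e2] at h
      generalize bilat (ratioCoeff b q) q (x / y / q ^ n) = E0 at h ⊢
      generalize bilat (ratioCoeff b q) q (x / y / q ^ (n + 1)) = E1 at h ⊢
      generalize bilat (ratioCoeff b q) q (x / y / q ^ (n + 2)) = E2 at h ⊢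
      have := congrArg (fun t => -(y / x * q ^ n * (1 / (q * b)) ^ n / b) * t) h
      simp only [mul_zero] at this
      rw [← this, pow_succ (1 / (q * b)) (n + 1), pow_succ (1 / (q * b)) n, pow_succ q (n + 1),
        pow_succ q n]
      field_simp
      ring
  have hs : ∀ n : ℕ, x ^ n * bilat (muCoeff x b q) q (y * q ^ n)
      + (y / x * q ^ (n + 1) - 1)
        * (x ^ (n + 1) * bilat (muCoeff x b q) q (y * q ^ (n + 1)))
      - y / x * b * q ^ (n + 2)
        * (x ^ (n + 2) * bilat (muCoeff x b q) q (y * q ^ (n + 2))) = 0 := fun n => by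
    have h := bilat_muCoeff_recurrence hq hq0 hx0 hb (mul_ne_zero hy (pow_ne_zero n hq0)) hxb
    have e1 : q * (y * q ^ n) = y * q ^ (n + 1) := by ring
    have e2 : q ^ 2 * (y * q ^ n) = y * q ^ (n + 2) := by ring
    rw [e1, e2] at h
    generalize bilat (muCoeff x b q) q (y * q ^ n) = E0 at h ⊢
    generalize bilat (muCoeff x b q) q (y * q ^ (n + 1)) = E1 at h ⊢
    generalize bilat (muCoeff x b q) q (y * q ^ (n + 2)) = E2 at h ⊢
    have := congrArg (fun t => x ^ n * t) h
    simp only [mul_zero] at this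
    rw [← this, pow_succ x (n + 1), pow_succ x n]
    field_simp
    ring
  have hs' : ∀ n : ℕ, (1 / (q * b * x)) ^ n * bilat (muCoeff x b q) q (y / q ^ n)
      + (x / y * q ^ (n + 1) - 1)
        * ((1 / (q * b * x)) ^ (n + 1) * bilat (muCoeff x b q) q (y / q ^ (n + 1)))
      - x / y * b * q ^ (n + 2)
        * ((1 / (q * b * x)) ^ (n + 2) * bilat (muCoeff x b q) q (y / q ^ (n + 2))) = 0 :=
    fun n => by
      have h := bilat_muCoeff_recurrence hq hq0 hx0 hb
        (div_ne_zero hy (pow_ne_zero (n + 2) hq0)) hxb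
      have e1 : q * (y / q ^ (n + 2)) = y / q ^ (n + 1) := by
        rw [pow_succ q (n + 1)]; field_simp
      have e2 : q ^ 2 * (y / q ^ (n + 2)) = y / q ^ n := by
        rw [pow_add]; field_simp
      rw [e1, e2] at h
      generalize bilat (muCoeff x b q) q (y / q ^ n) = E0 at h ⊢
      generalize bilat (muCoeff x b q) q (y / q ^ (n + 1)) = E1 at h ⊢
      generalize bilat (muCoeff x b q) q (y / q ^ (n + 2)) = E2 at h ⊢
      have := congrArg (fun t => -(q ^ n * (1 / (q * b * x)) ^ n / (y * b * x)) * t) h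
      simp only [mul_zero] at this
      rw [← this, pow_succ (1 / (q * b * x)) (n + 1), pow_succ (1 / (q * b * x)) n,
        pow_succ q (n + 1), pow_succ q n]
      field_simp
      ring
  have c1 := casoratian_eq hq hq0 (hrec hw) hk (tendsto_bilat_ratioCoeff hq hq0 b hw)
    ((tendsto_bilat_mul_zpow_neg (tailBounded_ratioCoeff hq b) (tendsto_ratioCoeff hq b) hq hq0
      hw').congr fun n => by
        have e : (q * (y / x) * b) ^ n = ((x / y) ^ n)⁻¹ * (q * b) ^ n := by
          rw [← inv_pow, ← mul_pow]; congr 1; field_simp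
        rw [e, one_div, inv_pow]
        field_simp)
  have c2 := casoratian_eq hq hq0 (hrec hw) hs (tendsto_bilat_ratioCoeff hq hq0 b hw)
    ((tendsto_bilat_muCoeff_zero hq hq0 hx0 hb hy hxb).congr fun n => by
        have e : (q * b * y) ^ n = (q * (y / x) * b) ^ n * x ^ n := by
          rw [← mul_pow]; congr 1; field_simp
        rw [e]
        ring)
  have c3 := casoratian_eq hq hq0 (hrec hw') hs' (tendsto_bilat_ratioCoeff hq hq0 b hw')
    ((tendsto_bilat_mul_zpow_neg (.of_tendsto hb (tendsto_muCoeff hq hq0 x b)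
      (tendsto_muCoeff_neg hq hq0 hx0 hb hxb)) (tendsto_muCoeff hq hq0 x b) hq hq0
      hy).congr fun n => by
        have e : (q * (x / y) * b) ^ n = (y ^ n)⁻¹ * (q * b * x) ^ n := by
          rw [← inv_pow, ← mul_pow]; congr 1; field_simp
        rw [e, one_div, inv_pow]
        field_simp)
  have r1 := bilat_muCoeff_recurrence hq hq0 hx0 hb (div_ne_zero hy hq0) hxb
  have r2 := bilat_ratioCoeff_recurrence hq hq0 b (div_ne_zero hw' hq0)
  have e1 : q * (y / q) = y := by field_simp
  have e2 : q ^ 2 * (y / q) = y * q := by field_simp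
  have e3 : q * (x / y / q) = x / y := by field_simp
  have e4 : q ^ 2 * (x / y / q) = x / y * q := by field_simp
  rw [e1, e2] at r1
  rw [e3, e4] at r2
  simp only [pow_zero, mul_one, div_one, pow_one, one_mul] at c1 c2 c3
  set κ1 := qpinf (q * b) q / qpinf q q * bilat 1 q (x / y)
  set κ2 := qtheta q (q * x) / qtheta q (q * (x * b)) * bilat 1 q (1 / (q * b * y))
  generalize bilat 1 q y = κ3 at *
  generalize bilat (muCoeff x b q) q y = S0 at *
  generalize bilat (muCoeff x b q) q (y * q) = S1 at *
  generalize bilat (muCoeff x b q) q (y / q) = Sm at *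
  generalize bilat (ratioCoeff b q) q (y / x) = h0 at *
  generalize bilat (ratioCoeff b q) q (y / x * q) = h1 at *
  generalize bilat (ratioCoeff b q) q (x / y) = k0 at *
  generalize bilat (ratioCoeff b q) q (x / y / q) = k1 at *
  generalize bilat (ratioCoeff b q) q (x / y * q) = km at *
  clear_value κ1 κ2
  clear hk hs hs' hrec e1 e2 e3 e4 hxb
  linear_combination (norm := (field_simp; ring)) S0 * (x / y) * c1 - k0 * (x / y) * c2 + h0 * c3
    - h0 * S0 * r2 - h0 * k0 / y * r1

/-! ### The `μ`-function as a bilateral series -/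

lemma e_add (z w : ℂ) : e (z + w) = e z * e w := by
  simp only [e, mul_add, Complex.exp_add]

lemma e_ne_zero (z : ℂ) : e z ≠ 0 := Complex.exp_ne_zero _

lemma e_neg (z : ℂ) : e (-z) = (e z)⁻¹ := by
  simp only [e, mul_neg, Complex.exp_neg]

lemma e_int_mul (n : ℤ) (z : ℂ) : e (n * z) = e z ^ n := by
  rw [e, e, ← Complex.exp_int_mul]; congr 1; ring

lemma norm_e_lt_one {τ : ℂ} (hτ : 0 < τ.im) : ‖e τ‖ < 1 := by
  rw [e, Complex.norm_exp, Real.exp_lt_one_iff]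
  simp
  positivity

/-- The bilateral sum in `genMu` as a value of `bilat`. -/
lemma genMu_eq_bilat (τ u v α : ℂ) :
    genMu τ u v α = Complex.I * e (-τ / 8) * e (α * (u - v) / 2) * e v /
      (qpinf (e τ) (e τ) * qtheta (e τ) (e v)) *
        bilat (muCoeff (e u) (1 / e (α * τ)) (e τ)) (e τ) (e v) := by
  have hsum : (∑' n : ℤ, (-1 : ℂ) ^ n * e (((n : ℂ) + 1 / 2) * v) * (e τ) ^ ((n * (n + 1)) / 2) *
      (qpinf (e u * (e τ) ^ (n + 1)) (e τ) /
       qpinf (e u * e (τ * ((n : ℂ) - α + 1))) (e τ))) =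
      e (v / 2) * bilat (muCoeff (e u) (1 / e (α * τ)) (e τ)) (e τ) (e v) := by
    rw [bilat, ← tsum_mul_left]
    refine tsum_congr fun n => ?_
    have h1 : e (((n : ℂ) + 1 / 2) * v) = e v ^ n * e (v / 2) := by
      rw [← e_int_mul, ← e_add]; congr 1; ring
    have h2 : e u * e (τ * ((n : ℂ) - α + 1)) = e u * (1 / e (α * τ)) * e τ ^ (n + 1) := by
      rw [← e_int_mul, one_div, ← e_neg, ← e_add, ← e_add, ← e_add]; congr 1; push_cast; ring
    rw [h1, h2, muCoeff, thetaCoeff]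
    ring
  have h8 : e (-τ / 8) = (e (τ / 8))⁻¹ := by rw [← e_neg]; congr 1; ring
  have hv2 : e (-v / 2) = (e (v / 2))⁻¹ := by rw [← e_neg]; congr 1; ring
  have hv : e v = e (v / 2) * e (v / 2) := by rw [← e_add]; congr 1; ring
  rw [genMu, hsum, theta11, h8, hv2]
  have := e_ne_zero (τ / 8)
  have := e_ne_zero (v / 2)
  generalize bilat _ _ _ = S
  generalize qtheta _ _ = T
  generalize qpinf _ _ = P
  rw [hv]
  have hI : (-Complex.I)⁻¹ = Complex.I := by simp
  simp only [div_eq_mul_inv, mul_inv, hI, inv_inv]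
  ring

lemma qtheta_div_q {q z : ℂ} (hq : ‖q‖ < 1) (hq0 : q ≠ 0) (hz : z ≠ 0) :
    qtheta q (z / q) = -(z / q * qtheta q z) := by
  have h := qtheta_q_mul hq hq0 (div_ne_zero hz hq0)
  rw [mul_div_cancel₀ _ hq0] at h
  rw [h]; field_simp

lemma qtheta_div_q_sq {q z : ℂ} (hq : ‖q‖ < 1) (hq0 : q ≠ 0) (hz : z ≠ 0) :
    qtheta q (z / q ^ 2) = z ^ 2 / q ^ 3 * qtheta q z := by
  rw [pow_two, ← div_div, qtheta_div_q hq hq0 (div_ne_zero hz hq0), qtheta_div_q hq hq0 hz]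
  field_simp

end QSeries

theorem stmt2 (τ u v α : ℂ) (hτ : 0 < τ.im)
    (hu : ∀ m n : ℤ, u ≠ (m : ℂ) + (n : ℂ) * τ)
    (hv : ∀ m n : ℤ, v ≠ (m : ℂ) + (n : ℂ) * τ)
    (q x y a : ℂ)
    (hq : q = e τ) (hx : x = e u) (hy : y = e v) (ha : a = e (α * τ))
    (h1 : ∀ m : ℤ, y ≠ q ^ m)
    (h2 : ∀ m : ℤ, x / a ≠ q ^ m)
    (h3 : ∀ m : ℤ, a / q ^ 2 ≠ q ^ m)
    (h4 : ∀ m : ℤ, x / y ≠ q ^ m)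
    (h5 : ∀ m : ℕ, q * x / y ≠ q ^ (-(m : ℤ)))
    (h6 : ∀ m : ℕ, q * y / x ≠ q ^ (-(m : ℤ))) :
    genMu τ u v α =
      - Complex.I * e (-τ / 8) * e (α * (u - v) / 2) * (a / x) *
          (qtheta q (x / q ^ 2) * qtheta q (q * y / a) * qpinf a q * qpinf (q * x / y) q) /
          (qtheta q (a / q ^ 2) * qtheta q y * qtheta q (x / a) * qtheta q (x / y)) *
        phi01 (q * x / y) q (q ^ 2 * x / (a * y))
      - Complex.I * e (-τ / 8) * e (α * (u - v) / 2) * (a / y) *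
          (qtheta q (y / q ^ 2) * qtheta q (q * x / a) * qpinf a q * qpinf (q * y / x) q) /
          (qtheta q (a / q ^ 2) * qtheta q y * qtheta q (x / a) * qtheta q (y / x)) *
        phi01 (q * y / x) q (q ^ 2 * y / (a * x)) := by
  have hq0 : q ≠ 0 := hq ▸ e_ne_zero τ
  have hx0 : x ≠ 0 := hx ▸ e_ne_zero u
  have hy0 : y ≠ 0 := hy ▸ e_ne_zero v
  have ha0 : a ≠ 0 := ha ▸ e_ne_zero _
  have hq1 : ‖q‖ < 1 := hq ▸ norm_e_lt_one hτ
  rw [genMu_eq_bilat, ← hq, ← hx, ← hy, ← ha]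
  have hphi {c d : ℂ} (hc : c ≠ 0) (hd : d ≠ 0) (h : ∀ m : ℕ, q * c / d ≠ q ^ (-(m : ℤ))) :
      qpinf (q * c / d) q * phi01 (q * c / d) q (q ^ 2 * c / (a * d)) =
        bilat (ratioCoeff (1 / a) q) q (c / d) := by
    have := qpinf_mul_phi01 hq1 hq0 (1 / a) (c := q * c / d)
      (div_ne_zero (mul_ne_zero hq0 hc) hd) fun m hm => h m <| by
        rw [zpow_neg, zpow_natCast]; exact eq_inv_of_mul_eq_one_left hm
    rwa [show q * c / d * q * (1 / a) = q ^ 2 * c / (a * d) by field_simp,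
      show q * c / d / q = c / d by field_simp] at this
  have p1 := hphi hx0 hy0 h5
  have p2 := hphi hy0 hx0 h6
  have key := bilat_muCoeff_connection (x := x) (b := 1 / a) (y := y) hq1 hq0 hx0
    (one_div_ne_zero ha0) hy0 fun m => by rw [mul_one_div]; exact h2 m
  have t1 : qtheta q (q * (x / y)) = qtheta q (y / x) := by
    rw [← qtheta_q_div hq0 (div_ne_zero hy0 hx0)]; congr 1; field_simp
  have t2 : qtheta q (q * (1 / (q * (1 / a) * y))) = qtheta q (q * y / a) := by
    rw [← qtheta_q_div hq0 (div_ne_zero (mul_ne_zero hq0 hy0) ha0)]; congr 1; field_simp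
  have t3 : qtheta q (x / y) = -(x / y * qtheta q (y / x)) := by
    rw [← qtheta_q_div hq0 (div_ne_zero hx0 hy0), show q / (x / y) = q * (y / x) by field_simp,
      qtheta_q_mul hq1 hq0 (div_ne_zero hy0 hx0)]
    field_simp
  have t4 : qtheta q (q * x / a) = -(a / x * qtheta q (x / a)) := by
    rw [mul_div_assoc, qtheta_q_mul hq1 hq0 (div_ne_zero hx0 ha0)]
    field_simp
  have nq : qpinf q q ≠ 0 := qpinf_ne_zero hq1 fun j => mul_pow_ne_one hq1 j
  have ny := qtheta_ne_zero hq1 hq0 hy0 h1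
  have nxa := qtheta_ne_zero hq1 hq0 (div_ne_zero hx0 ha0) h2
  have nxy := qtheta_ne_zero hq1 hq0 (div_ne_zero hx0 hy0) h4
  have naq := qtheta_ne_zero hq1 hq0 (div_ne_zero ha0 (pow_ne_zero 2 hq0)) h3
  rw [t3, neg_ne_zero, mul_ne_zero_iff] at nxy
  have nyx := nxy.2
  rw [qtheta_div_q_sq hq1 hq0 ha0, qtheta] at naq
  have nA := left_ne_zero_of_mul (right_ne_zero_of_mul naq)
  have nQA := right_ne_zero_of_mul (right_ne_zero_of_mul naq)
  rw [bilat_one hq1 hq0 (div_ne_zero hx0 hy0), bilat_one hq1 hq0 hy0,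
    bilat_one hq1 hq0 (one_div_ne_zero (mul_ne_zero (mul_ne_zero hq0 (one_div_ne_zero ha0)) hy0)),
    t1, t2, mul_one_div, mul_one_div, ← mul_div_assoc q x a, t4, qtheta_q_mul hq1 hq0 hx0,
    qtheta_q_mul hq1 hq0 hy0, ← p1, ← p2] at key
  rw [qtheta_div_q_sq hq1 hq0 ha0, qtheta_div_q_sq hq1 hq0 hx0, qtheta_div_q_sq hq1 hq0 hy0,
    t3, t4, qtheta.eq_1 q a]
  clear p1 p2 t1 t2 t3 t4 naq nxy hphi
  generalize bilat (muCoeff x (1 / a) q) q y = S at *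
  generalize qtheta q (y / x) = T1 at *
  generalize qtheta q (x / a) = T2 at *
  generalize qtheta q (q * y / a) = T3 at *
  generalize qtheta q y = T4 at *
  generalize qtheta q x = T5 at *
  generalize qpinf q q = P at *
  generalize qpinf a q = A at *
  generalize qpinf (q / a) q = B at *
  generalize qpinf (q * x / y) q = C1 at *
  generalize qpinf (q * y / x) q = C2 at *
  generalize phi01 _ _ _ = F1 at *
  generalize phi01 _ _ _ = F2 at *
  have hS : S = y / x / (B * T1) * (C1 * F1 * (x / y) * (T5 / (a * T2) * (P * T3)) +
      C2 * F2 * (P * T4 / y)) := by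
    field_simp at key ⊢
    linear_combination key
  rw [hS]
  field_simp
  ring
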